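/- Every dominating family for convex embeddability on linear orders on ℕ has cardinality exactly the continuum: if ℱ is a set of linear orders on ℕ such that every linear order on ℕ convexly embeds into some member of ℱ, then the cardinality of ℱ is 2^{ℵ₀}. -/

import Mathlib

/-- `L` convexly embeds into `L'` (`L ⊴ L'`). -/
def CvxEmb (L L' : LinearOrder ℕ) : Prop :=
  ∃ f : ℕ → ℕ, (∀ a b : ℕ, L.le a b ↔ L'.le (f a) (f b)) ∧
    ∀ x y z : ℕ, L'.le x y → L'.le y z →
      x ∈ Set.range f → z ∈ Set.range f → y ∈ Set.range f

open Cardinal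

/-- The finite condensation class of `a`: the points at finite distance from `a`. -/
def finiteCondensation {α : Type*} [LinearOrder α] (a : α) : Set α :=
  {b | (Set.uIcc a b).Finite}

theorem OrderIso.image_finiteCondensation {α β : Type*} [LinearOrder α] [LinearOrder β]
    (e : α ≃o β) (a : α) : e '' finiteCondensation a = finiteCondensation (e a) := by
  have key (b : α) : e '' Set.uIcc a b = Set.uIcc (e a) (e b) := by
    simp only [Set.uIcc, e.image_Icc, map_inf, map_sup]
  ext c
  obtain ⟨b, rfl⟩ := e.surjective c
  simp only [e.injective.mem_set_image, finiteCondensation, Set.mem_ofPred_eq, ← key,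
    Set.finite_image_iff e.injective.injOn]

/-- The ordered sum over `Q` of finite blocks, the block at `q` having `s q + 1` points. -/
abbrev BlockSum {Q : Type*} (s : Q → ℕ) : Type _ := Σₗ q : Q, Fin (s q + 1)

namespace BlockSum

variable {Q : Type*} [LinearOrder Q]

/-- The `i`-th point of the block at `q`. -/
abbrev mk {s : Q → ℕ} (q : Q) (i : Fin (s q + 1)) : BlockSum s := toLex ⟨q, i⟩

theorem infinite_Icc [DenselyOrdered Q] {s : Q → ℕ} {q r : Q} (h : q < r)
    (i : Fin (s q + 1)) (j : Fin (s r + 1)) : (Set.Icc (mk q i) (mk r j)).Infinite := by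
  have hinj : Function.Injective (fun t : Q ↦ (mk t 0 : BlockSum s)) :=
    fun a b hab ↦ congrArg (fun z : BlockSum s ↦ (ofLex z).1) hab
  refine ((Set.Ioo_infinite h).image hinj.injOn).mono ?_
  rintro _ ⟨t, ht, rfl⟩
  exact ⟨Sigma.Lex.le_def.2 (Or.inl ht.1), Sigma.Lex.le_def.2 (Or.inl ht.2)⟩

theorem finiteCondensation_mk [DenselyOrdered Q] {s : Q → ℕ} (q : Q) (i : Fin (s q + 1)) :
    finiteCondensation (mk q i) = Set.range (mk q : Fin (s q + 1) → BlockSum s) := by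
  ext ⟨r, j⟩
  change (Set.uIcc (mk q i) (mk r j)).Finite ↔ mk r j ∈ _
  constructor
  · intro h
    rcases lt_trichotomy q r with hqr | rfl | hqr
    · exact absurd (h.subset Set.Icc_subset_uIcc) (infinite_Icc hqr i j)
    · exact ⟨j, rfl⟩
    · exact absurd (h.subset Set.Icc_subset_uIcc') (infinite_Icc hqr j i)
  · rintro ⟨k, hk⟩
    rw [← hk]
    refine (Set.finite_range (mk q : Fin (s q + 1) → BlockSum s)).subset ?_
    have aux (k l : Fin (s q + 1)) :
        Set.Icc (mk q k : BlockSum s) (mk q l) ⊆ Set.range (mk q) := by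
      rintro ⟨t, m⟩ ⟨h₁, h₂⟩
      have h₁ : q ≤ t := (Sigma.Lex.le_def.1 h₁).elim le_of_lt fun h ↦ h.1.le
      have h₂ : t ≤ q := (Sigma.Lex.le_def.1 h₂).elim le_of_lt fun h ↦ h.1.le
      obtain rfl := le_antisymm h₁ h₂
      exact ⟨m, rfl⟩
    rcases le_total (mk q i : BlockSum s) (mk q k) with h | h
    · rw [Set.uIcc_of_le h]
      exact aux i k
    · rw [Set.uIcc_of_ge h]
      exact aux k i

theorem ncard_finiteCondensation_mk [DenselyOrdered Q] {s : Q → ℕ} (q : Q)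
    (i : Fin (s q + 1)) : (finiteCondensation (mk q i : BlockSum s)).ncard = s q + 1 := by
  have hinj : Function.Injective (mk q : Fin (s q + 1) → BlockSum s) := fun a b h ↦
    eq_of_heq (Sigma.mk.inj (toLex.injective h)).2
  rw [finiteCondensation_mk, ← Set.image_univ, Set.ncard_image_of_injective _ hinj,
    Set.ncard_univ, Nat.card_fin]

theorem range_subset_of_orderIso [DenselyOrdered Q] {s t : Q → ℕ}
    (e : BlockSum s ≃o BlockSum t) : Set.range s ⊆ Set.range t := by
  rintro _ ⟨q, rfl⟩
  obtain ⟨⟨r, j⟩, h⟩ : ∃ z, e (mk q 0) = z := ⟨_, rfl⟩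
  refine ⟨r, ?_⟩
  have h₁ := e.image_finiteCondensation (mk q 0)
  rw [h] at h₁
  have h₂ := congrArg Set.ncard h₁
  rw [Set.ncard_image_of_injective _ e.injective, ncard_finiteCondensation_mk] at h₂
  have h₃ := ncard_finiteCondensation_mk (s := t) r j
  exact Nat.succ_injective (h₃.symm.trans h₂.symm)

end BlockSum

/-- An order embedding of a bounded order with convex range has range `[f ⊥, f ⊤]`. -/
theorem OrderEmbedding.range_eq_Icc {α β : Type*} [PartialOrder α] [BoundedOrder α]
    [PartialOrder β] (f : α ↪o β) (hf : (Set.range f).OrdConnected) :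
    Set.range f = Set.Icc (f ⊥) (f ⊤) := by
  refine Set.Subset.antisymm ?_ (hf.out ⟨⊥, rfl⟩ ⟨⊤, rfl⟩)
  rintro _ ⟨a, rfl⟩
  exact ⟨f.le_iff_le.2 bot_le, f.le_iff_le.2 le_top⟩

/-- Bounded orders embedded convexly with the same endpoints are isomorphic. -/
theorem nonempty_orderIso_of_convex_embeddings {α β γ : Type*} [PartialOrder α] [BoundedOrder α]
    [PartialOrder β] [BoundedOrder β] [PartialOrder γ] (f : α ↪o γ) (g : β ↪o γ)
    (hf : (Set.range f).OrdConnected) (hg : (Set.range g).OrdConnected)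
    (hbot : f ⊥ = g ⊥) (htop : f ⊤ = g ⊤) : Nonempty (α ≃o β) := by
  have h : Set.range f = Set.range g := by
    rw [f.range_eq_Icc hf, g.range_eq_Icc hg, hbot, htop]
  exact ⟨f.orderIso.trans ((OrderIso.setCongr _ _ h).trans g.orderIso.symm)⟩

/-- `ℕ` equipped with the linear order `M` instead of its usual order. -/
def OrderedBy (_M : LinearOrder ℕ) : Type := ℕ

instance (M : LinearOrder ℕ) : LinearOrder (OrderedBy M) := M

theorem mk_orderedBy (M : LinearOrder ℕ) : #(OrderedBy M) = ℵ₀ := mk_nat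

theorem exists_convex_embedding_of_dominating {F : Set (LinearOrder ℕ)}
    (hF : ∀ L : LinearOrder ℕ, ∃ M ∈ F, CvxEmb L M) (α : Type*) [LinearOrder α] [Countable α]
    [Infinite α] :
    ∃ M : F, ∃ f : α ↪o OrderedBy M.1, (Set.range f).OrdConnected := by
  obtain ⟨e⟩ := nonempty_equiv_of_countable (α := α) (β := ℕ)
  obtain ⟨M, hM, f, hle, hconv⟩ := hF (LinearOrder.lift' e.symm e.symm.injective)
  refine ⟨⟨M, hM⟩, OrderEmbedding.ofMapLEIff (β := OrderedBy M) (fun a ↦ f (e a))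
    fun a b ↦ (hle _ _).symm.trans ?_, ?_⟩
  · change e.symm (e a) ≤ e.symm (e b) ↔ a ≤ b
    simp
  · refine ⟨?_⟩
    rintro _ ⟨a, rfl⟩ _ ⟨b, rfl⟩ y hy
    obtain ⟨k, hk⟩ := hconv _ y _ hy.1 hy.2 ⟨e a, rfl⟩ ⟨e b, rfl⟩
    exact ⟨e.symm k, (congrArg f (e.apply_symm_apply k)).trans hk⟩

open Classical in
/-- Block sizes on `Q` whose nonzero values are exactly the successors of elements of `x`. -/
noncomputable def blockSize {Q : Type*} (φ : Q ≃ ℕ) (x : Set ℕ) (q : Q) : ℕ :=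
  if φ q ∈ x then φ q + 1 else 0

theorem succ_mem_range_blockSize {Q : Type*} (φ : Q ≃ ℕ) {x : Set ℕ} {n : ℕ} :
    n + 1 ∈ Set.range (blockSize φ x) ↔ n ∈ x := by
  constructor
  · rintro ⟨q, hq⟩
    unfold blockSize at hq
    split_ifs at hq with h
    rwa [← Nat.succ_injective hq]
  · intro hn
    exact ⟨φ.symm n, by simp [blockSize, hn]⟩

theorem blockSize_subset_of_orderIso {Q : Type*} [LinearOrder Q] [DenselyOrdered Q] (φ : Q ≃ ℕ)
    {x y : Set ℕ} (e : BlockSum (blockSize φ x) ≃o BlockSum (blockSize φ y)) : x ⊆ y :=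
  fun _ hn ↦ (succ_mem_range_blockSize φ).1
    (BlockSum.range_subset_of_orderIso e ((succ_mem_range_blockSize φ).2 hn))

theorem mk_linearOrder_nat_le : #(LinearOrder ℕ) ≤ 𝔠 := by
  have hinj : Function.Injective
      (fun L : LinearOrder ℕ ↦ {p : ℕ × ℕ | L.le p.1 p.2}) := fun L L' h ↦
    LinearOrder.ext fun a b ↦ Set.ext_iff.1 h (a, b)
  simpa using mk_le_of_injective hinj

theorem continuum_le_mk_of_dominating {F : Set (LinearOrder ℕ)}
    (hF : ∀ L : LinearOrder ℕ, ∃ M ∈ F, CvxEmb L M) : 𝔠 ≤ #F := by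
  let Q := Set.Icc (0 : ℚ) 1
  have : Fact ((0 : ℚ) ≤ 1) := ⟨zero_le_one⟩
  have : Infinite Q := (Set.Icc_infinite zero_lt_one).to_subtype
  obtain ⟨φ⟩ := nonempty_equiv_of_countable (α := Q) (β := ℕ)
  have (x : Set ℕ) : Infinite (BlockSum (blockSize φ x)) :=
    Infinite.of_surjective (fun z ↦ (ofLex z).1) fun q ↦ ⟨BlockSum.mk q 0, rfl⟩
  have (x : Set ℕ) : Countable (BlockSum (blockSize φ x)) :=
    inferInstanceAs (Countable (Σ q : Q, Fin (blockSize φ x q + 1)))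
  choose M f hf using fun x : Set ℕ ↦
    exists_convex_embedding_of_dominating hF (BlockSum (blockSize φ x))
  let ψ (x : Set ℕ) : Σ M : F, OrderedBy M.1 × OrderedBy M.1 := ⟨M x, f x ⊥, f x ⊤⟩
  have hsub (x y : Set ℕ) (h : ψ x = ψ y) : x ⊆ y := by
    obtain ⟨hM, hends⟩ := Sigma.mk.inj h
    have hfx := hf x
    have hfy := hf y
    generalize f x = g at *
    generalize f y = g' at *
    generalize M x = N at *
    subst hM
    obtain ⟨hbot, htop⟩ := Prod.mk.inj (eq_of_heq hends)
    obtain ⟨e⟩ := nonempty_orderIso_of_convex_embeddings g g' hfx hfy hbot htop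
    exact blockSize_subset_of_orderIso φ e
  have hinj : Function.Injective ψ := fun x y h ↦ (hsub x y h).antisymm (hsub y x h.symm)
  have hle : 𝔠 ≤ #F * ℵ₀ := by simpa [mk_orderedBy] using mk_le_of_injective hinj
  by_contra! hlt
  exact hle.not_gt (mul_lt_of_lt aleph0_le_continuum hlt aleph0_lt_continuum)

/-- Every dominating family for convex embeddability on linear orders on `ℕ`
has cardinality exactly the continuum. -/
theorem cvxEmb_dominating_family_has_size_continuum
    (F : Set (LinearOrder ℕ))
    (hF : ∀ L : LinearOrder ℕ, ∃ M ∈ F, CvxEmb L M) :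
    Cardinal.mk F = Cardinal.continuum :=
  ((mk_set_le F).trans mk_linearOrder_nat_le).antisymm (continuum_le_mk_of_dominating hF)
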